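/- Let G = K₅ ∪_{K₃} K₅ be the graph obtained by gluing two copies of the complete graph K₅ along a common copy of K₃ (so G has 7 vertices and 17 = 3·7 − 4 edges). Then there exists a placement q ∈ Σ^V of G in Σ such that the framework (G,q) is full in Σ and infinitesimally rigid; thus K₅ ∪_{K₃} K₅ is (minimally) rigid in the hypercylinder Σ. -/

import Mathlib

open Matrix BigOperators

/-- The hypercylinder Σ in ℝ⁴. -/
def Hyp : Set (Fin 4 → ℝ) := {x | x 0 ^ 2 + x 1 ^ 2 + x 2 ^ 2 = 1}

/-- π(x)·π(y), where π : ℝ⁴ → ℝ³ drops the last coordinate. -/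
def piDot (x y : Fin 4 → ℝ) : ℝ := x 0 * y 0 + x 1 * y 1 + x 2 * y 2

/-- The Euclidean inner product on ℝ⁴. -/
def dot4 (x y : Fin 4 → ℝ) : ℝ := ∑ i, x i * y i

/-- The pair (B,c) determines an infinitesimal rigid motion η(x) = Bx + c of Σ. -/
def InTSigma (B : Matrix (Fin 4) (Fin 4) ℝ) (c : Fin 4 → ℝ) : Prop :=
  Bᵀ = -B ∧ ∀ x ∈ Hyp, piDot (B.mulVec x + c) x = 0

/-- m is an infinitesimal flex of the framework (G,q) in Σ. -/
def IsFlex {V : Type*} (G : SimpleGraph V) (q m : V → Fin 4 → ℝ) : Prop :=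
  (∀ u v, G.Adj u v → dot4 (m u - m v) (q u - q v) = 0) ∧
    (∀ v, piDot (m v) (q v) = 0)

/-- The framework (G,q) is full in Σ. -/
def Full {V : Type*} (G : SimpleGraph V) (q : V → Fin 4 → ℝ) : Prop :=
  ∀ (B : Matrix (Fin 4) (Fin 4) ℝ) (c : Fin 4 → ℝ), InTSigma B c →
    (∀ v, B.mulVec (q v) + c = 0) → B = 0 ∧ c = 0

/-- The framework (G,q) is infinitesimally rigid in Σ. -/
def InfRigid {V : Type*} (G : SimpleGraph V) (q : V → Fin 4 → ℝ) : Prop :=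
  ∀ m : V → Fin 4 → ℝ, IsFlex G q m →
    ∃ (B : Matrix (Fin 4) (Fin 4) ℝ) (c : Fin 4 → ℝ), InTSigma B c ∧
      ∀ v, m v = B.mulVec (q v) + c

/-- The graph K₅ ∪_{K₃} K₅ on 7 vertices: two copies of K₅, with vertex sets
{0,1,2,3,4} and {2,3,4,5,6}, glued along the common K₃ on {2,3,4}. -/
def K5K3K5 : SimpleGraph (Fin 7) :=
  SimpleGraph.fromRel (fun u v => (u.val ≤ 4 ∧ v.val ≤ 4) ∨ (2 ≤ u.val ∧ 2 ≤ v.val))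

/-- An integral placement of `K5K3K5` in the hypercylinder. -/
def placement : Fin 7 → Fin 4 → ℝ :=
  ![![0, 0, 1, 0], ![-1, 0, 0, 1], ![1, 0, 0, 0], ![0, 1, 0, 0], ![0, 0, 1, 1],
    ![0, -1, 0, 1], ![1, 0, 0, -1]]

instance : DecidableRel K5K3K5.Adj := fun u v => by
  unfold K5K3K5
  rw [SimpleGraph.fromRel_adj]
  infer_instance

theorem ncard_edgeSet_K5K3K5 : K5K3K5.edgeSet.ncard = 17 := by
  rw [← SimpleGraph.coe_edgeFinset, Set.ncard_coe_finset]
  decide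

theorem placement_mem_hyp (v : Fin 7) : placement v ∈ Hyp := by
  fin_cases v <;> simp [placement, Hyp]

theorem full_placement : Full K5K3K5 placement := by
  rintro B c ⟨hB, -⟩ h
  have skew (i j : Fin 4) : B j i = -B i j := congrFun (congrFun hB i) j
  have eq (v : Fin 7) (i : Fin 4) := congrFun (h v) i
  simp only [Fin.forall_fin_succ, Fin.forall_fin_zero, Matrix.mulVec, dotProduct,
    Fin.sum_univ_four, placement, Pi.add_apply, Pi.zero_apply] at eq skew
  simp at eq skew
  constructor
  · ext i j
    fin_cases i <;> fin_cases j <;> simp <;> linarith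
  · ext i
    fin_cases i <;> simp <;> linarith

theorem infRigid_placement : InfRigid K5K3K5 placement := by
  rintro m ⟨hE, hV⟩
  refine ⟨!![0, -m 2 1, -m 2 2, 0; m 2 1, 0, -m 3 2, 0; m 2 2, m 3 2, 0, 0; 0, 0, 0, 0],
    ![0, 0, 0, m 2 3], ⟨?_, ?_⟩, ?_⟩
  · ext i j
    fin_cases i <;> fin_cases j <;> simp
  · intro x _
    simp [piDot, dotProduct, Fin.sum_univ_four]
    ring
  · have h10 := hE 1 0 (by decide)
    have h20 := hE 2 0 (by decide)
    have h21 := hE 2 1 (by decide)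
    have h30 := hE 3 0 (by decide)
    have h31 := hE 3 1 (by decide)
    have h32 := hE 3 2 (by decide)
    have h40 := hE 4 0 (by decide)
    have h41 := hE 4 1 (by decide)
    have h42 := hE 4 2 (by decide)
    have h43 := hE 4 3 (by decide)
    have h52 := hE 5 2 (by decide)
    have h53 := hE 5 3 (by decide)
    have h54 := hE 5 4 (by decide)
    have h62 := hE 6 2 (by decide)
    have h63 := hE 6 3 (by decide)
    have h64 := hE 6 4 (by decide)
    have h65 := hE 6 5 (by decide)
    simp only [Fin.forall_fin_succ, Fin.forall_fin_zero, piDot, placement] at hV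
    clear hE
    simp [dot4, Fin.sum_univ_four, placement] at *
    intro v
    ext i
    fin_cases v <;> fin_cases i <;> simp <;> linarith

theorem stmt5 :
    K5K3K5.edgeSet.ncard = 17 ∧
      ∃ q : Fin 7 → Fin 4 → ℝ, (∀ v, q v ∈ Hyp) ∧ Full K5K3K5 q ∧ InfRigid K5K3K5 q := by
  exact ⟨ncard_edgeSet_K5K3K5, placement, placement_mem_hyp, full_placement, infRigid_placement⟩
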